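/- Let R be a local ring containing 1/2 (if R is not a field, assume its residue field has at least 5 elements). In the Witt K-theory ring KW_*(R), one has [a+b]·[ab(a+b)] = [a]·[b] for all units a, b of R such that a + b is also a unit. -/

import Mathlib

/-- The defining relations of the Witt `K`-theory ring of `R`: the generator `[a]`
(for `a ∈ Rˣ`) is encoded as `some a` (in degree `1`), and the generator `η` as
`none` (in degree `-1`). -/
inductive KWRel (R : Type) [CommRing R] :
    FreeAlgebra ℤ (Option Rˣ) → FreeAlgebra ℤ (Option Rˣ) → Prop
  /-- (WK1) `η·[a] = [a]·η`. -/
  | comm (a : Rˣ) : KWRel R (FreeAlgebra.ι ℤ none * FreeAlgebra.ι ℤ (some a))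
      (FreeAlgebra.ι ℤ (some a) * FreeAlgebra.ι ℤ none)
  /-- (WK2) `[ab] = [a] + [b] - η·[a]·[b]`. -/
  | mul (a b : Rˣ) : KWRel R (FreeAlgebra.ι ℤ (some (a * b)))
      (FreeAlgebra.ι ℤ (some a) + FreeAlgebra.ι ℤ (some b) -
        FreeAlgebra.ι ℤ none * FreeAlgebra.ι ℤ (some a) * FreeAlgebra.ι ℤ (some b))
  /-- (WK3) `[a]·[1-a] = 0` for `a, 1-a ∈ Rˣ`. -/
  | steinberg (a b : Rˣ) (h : (a : R) + (b : R) = 1) :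
      KWRel R (FreeAlgebra.ι ℤ (some a) * FreeAlgebra.ι ℤ (some b)) 0
  /-- (WK4) `2 = η·[-1]`. -/
  | hyperbolic : KWRel R 2 (FreeAlgebra.ι ℤ none * FreeAlgebra.ι ℤ (some (-1)))

/-- The Witt `K`-theory ring `KW_*(R)` of `R`: the quotient of the free `ℤ`-algebra on
generators `[a]` (`a ∈ Rˣ`, degree `1`) and `η` (degree `-1`) by the two-sided ideal
generated by the relations (WK1)–(WK4). -/
def KW (R : Type) [CommRing R] := RingQuot (KWRel R)

noncomputable instance (R : Type) [CommRing R] : Ring (KW R) :=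
  inferInstanceAs (Ring (RingQuot (KWRel R)))

namespace KW

variable (R : Type) [CommRing R]

/-- The degree-one generator `[a]` of `KW_*(R)`. -/
noncomputable def gen (a : Rˣ) : KW R :=
  RingQuot.mkRingHom (KWRel R) (FreeAlgebra.ι ℤ (some a))

/-- The degree-minus-one generator `η` of `KW_*(R)`. -/
noncomputable def eta : KW R :=
  RingQuot.mkRingHom (KWRel R) (FreeAlgebra.ι ℤ none)

/-- `⟨a⟩ := 1 - η·[a]` in `KW_0(R)`. -/
noncomputable def gu (a : Rˣ) : KW R := 1 - eta R * gen R a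

end KW

namespace KW

section RingLemmas

theorem commute_of_sq_eq {A : Type*} [Ring A] {t e x y : A} (hx : t * x = x * t)
    (hy : t * y = y * t) (hte : t * e = 2) (het : e * t = 2) (hxx : x * x = e * x)
    (hyy : y * y = e * y) (hxy : t * x * y = t * y * x)
    (h : (x + y - t * x * y) * (x + y - t * x * y) = e * (x + y - t * x * y)) :
    Commute x y := by
  have htxx : t * x * x = 2 * x := by rw [mul_assoc, hxx, ← mul_assoc, hte]
  have htyy : t * y * y = 2 * y := by rw [mul_assoc, hyy, ← mul_assoc, hte]
  have h₁ : x * (t * x * y) = 2 * (x * y) := by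
    rw [← mul_assoc, ← mul_assoc, ← hx, htxx, mul_assoc]
  have h₂ : t * x * y * x = 2 * (x * y) := by
    rw [hx, mul_assoc x, mul_assoc x, ← hxy, h₁]
  have h₃ : t * x * y * y = 2 * (x * y) := by
    rw [hx, mul_assoc x, mul_assoc x, htyy, two_mul, two_mul, mul_add]
  have h₄ : y * (t * x * y) = 2 * (x * y) := by
    rw [← h₃, ← mul_assoc, ← mul_assoc, ← hy, ← hxy]
  have h₅ : t * x * y * (t * x * y) = 4 * (x * y) := by
    have h : t * x * (x * y) = 2 * (x * y) := by rw [← mul_assoc, htxx, mul_assoc]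
    rw [mul_assoc (t * x) y, h₄, two_mul, mul_add, h, ← add_mul, two_add_two_eq_four]
  have h₆ : e * (t * x * y) = 2 * (x * y) := by
    rw [← mul_assoc, ← mul_assoc, het, mul_assoc]
  generalize t * x * y = w at *
  simp only [mul_add, add_mul, mul_sub, sub_mul, h₁, h₂, h₃, h₄, h₅, h₆, hxx, hyy] at h
  have h' : y * x - x * y = 0 := by
    rw [← sub_eq_zero] at h
    rw [← h]
    noncomm_ring
  exact (sub_eq_zero.mp h').symm

theorem mul_eq_mul_of_steinberg {A : Type*} [CommRing A] {t e x y z : A} (hte : t * e = 2)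
    (hzz : z * z = e * z) (h : (x + z - t * x * z) * (y + z - t * y * z) = 0) :
    z * (x + y - t * x * y + z - t * (x + y - t * x * y) * z) = x * y := by
  grind

/-- Pairwise commuting elements of a ring lie in a commutative subring. -/
theorem exists_commRing_of_pairwise_comm.{u} {B : Type u} [Ring B] {S : Set B}
    (hS : ∀ x ∈ S, ∀ y ∈ S, x * y = y * x) :
    ∃ (A : Type u) (_ : CommRing A) (f : A →+* B),
      Function.Injective f ∧ ∀ x ∈ S, ∃ y, f y = x := by
  have := Subring.isMulCommutative_closure hS
  exact ⟨Subring.closure S, { mul_comm := mul_comm' }, (Subring.closure S).subtype,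
    Subtype.val_injective, fun x hx => ⟨⟨x, Subring.subset_closure hx⟩, rfl⟩⟩

end RingLemmas

section Relations

variable {R : Type} [CommRing R]

theorem eta_mul_gen (a : Rˣ) : eta R * gen R a = gen R a * eta R := by
  have h := RingQuot.mkRingHom_rel (KWRel.comm a)
  rwa [map_mul, map_mul] at h

theorem gen_mul (a b : Rˣ) :
    gen R (a * b) = gen R a + gen R b - eta R * gen R a * gen R b := by
  have h := RingQuot.mkRingHom_rel (KWRel.mul a b)
  rwa [map_sub, map_add, map_mul, map_mul] at h

theorem gen_mul_gen_of_add_eq_one {a b : Rˣ} (h : (a : R) + b = 1) :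
    gen R a * gen R b = 0 := by
  have h := RingQuot.mkRingHom_rel (KWRel.steinberg a b h)
  rwa [map_mul, map_zero] at h

theorem eta_mul_gen_neg_one : eta R * gen R (-1) = 2 := by
  have h := RingQuot.mkRingHom_rel (KWRel.hyperbolic (R := R))
  rw [map_mul, map_ofNat] at h
  exact h.symm

theorem gen_one : gen R 1 = 0 := by
  have h := gen_mul (R := R) (-1) 1
  rw [mul_one, eta_mul_gen_neg_one, two_mul] at h
  rwa [add_sub_add_right_eq_sub, eq_comm, sub_eq_self] at h

theorem gen_neg (a : Rˣ) : gen R (-a) = gen R (-1) - gen R a := by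
  rw [← neg_one_mul a, gen_mul, eta_mul_gen_neg_one, two_mul]
  abel

theorem gen_mul_gen_neg_of_add_eq_one {a u : Rˣ} (h : (a : R) + u = 1) :
    gen R a * gen R (-a) = 0 := by
  set v : Rˣ := -(a⁻¹ * u) with hv
  have hav : ((a⁻¹ : Rˣ) : R) + v = 1 := by
    have : (u : R) = 1 - a := eq_sub_of_add_eq' h
    simp [hv, this, mul_sub]
  have huv : u = v * -a := by
    simp [hv, mul_comm]
  have hinv := gen_mul a a⁻¹
  rw [mul_inv_cancel, gen_one] at hinv
  have hx : gen R a = eta R * gen R a * gen R a⁻¹ - gen R a⁻¹ := by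
    rw [eq_sub_iff_add_eq]; exact (sub_eq_zero.mp hinv.symm)
  have hxv : gen R a * gen R v = 0 := by
    rw [hx, sub_mul, mul_assoc, gen_mul_gen_of_add_eq_one hav, mul_zero, sub_zero]
  have hau := gen_mul_gen_of_add_eq_one h
  rw [huv, gen_mul, mul_sub, mul_add, hxv, zero_add, ← mul_assoc, ← mul_assoc,
    ← eta_mul_gen, mul_assoc (eta R), hxv, mul_zero, zero_mul, sub_zero] at hau
  exact hau

theorem gen_mul_self_of_isUnit_one_sub {a : Rˣ} (h : IsUnit (1 - (a : R))) :
    gen R a * gen R a = gen R a * gen R (-1) := by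
  obtain ⟨u, hu⟩ := h
  have := gen_mul_gen_neg_of_add_eq_one (a := a) (u := u) (by rw [hu]; ring)
  rw [gen_neg, mul_sub, sub_eq_zero] at this
  exact this.symm

theorem gen_mul_self_of_isUnit_one_add {a : Rˣ} (h : IsUnit (1 + (a : R))) :
    gen R a * gen R a = gen R (-1) * gen R a := by
  obtain ⟨u, hu⟩ := h
  have := gen_mul_gen_neg_of_add_eq_one (a := -a) (u := u)
    (by rw [hu, Units.val_neg]; ring)
  rw [neg_neg, gen_neg, sub_mul, sub_eq_zero] at this
  exact this.symm

theorem gen_commute_neg_one_of_isUnit {a : Rˣ} (h₁ : IsUnit (1 - (a : R)))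
    (h₂ : IsUnit (1 + (a : R))) : Commute (gen R a) (gen R (-1)) :=
  (gen_mul_self_of_isUnit_one_sub h₁).symm.trans (gen_mul_self_of_isUnit_one_add h₂)

theorem gen_mul_commute {a b : Rˣ} {z : KW R} (hη : Commute (eta R) z)
    (ha : Commute (gen R a) z) (hb : Commute (gen R b) z) : Commute (gen R (a * b)) z := by
  rw [gen_mul]
  exact (ha.add_left hb).sub_left ((hη.mul_left ha).mul_left hb)

theorem eta_mul_gen_mul_gen_comm (a b : Rˣ) :
    eta R * gen R a * gen R b = eta R * gen R b * gen R a := by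
  have h := gen_mul b a
  rw [mul_comm b a, gen_mul, add_comm (gen R b)] at h
  exact sub_right_injective h

end Relations

section Commutative

variable {R : Type} [CommRing R]

/-- Once every `[a]` satisfies `[a]² = [-1]·[a]`, the generators commute. -/
theorem gen_commute (hsq : ∀ a : Rˣ, gen R a * gen R a = gen R (-1) * gen R a) (a b : Rˣ) :
    Commute (gen R a) (gen R b) := by
  have hab := hsq (a * b)
  rw [gen_mul] at hab
  exact commute_of_sq_eq (eta_mul_gen a) (eta_mul_gen b) eta_mul_gen_neg_one
    ((eta_mul_gen (-1)).symm.trans eta_mul_gen_neg_one) (hsq a) (hsq b)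
    (eta_mul_gen_mul_gen_comm a b) hab

open IsLocalRing in
theorem gen_mul_self [IsLocalRing R] [Invertible (2 : R)]
    (hR : IsField R ∨ 5 ≤ Cardinal.mk (ResidueField R)) (a : Rˣ) :
    gen R a * gen R a = gen R (-1) * gen R a := by
  by_cases h₂ : IsUnit (1 + (a : R))
  · exact gen_mul_self_of_isUnit_one_add h₂
  have h₁ : IsUnit (1 - (a : R)) := by
    by_contra h₁
    have h := nonunits_add h₁ h₂
    rw [show 1 - (a : R) + (1 + a) = 2 by ring] at h
    exact h (isUnit_of_invertible 2)
  rw [gen_mul_self_of_isUnit_one_sub h₁]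
  rcases hR with hR | hR
  · have ha : a = -1 := by
      have h0 : 1 + (a : R) = 0 := by
        by_contra h0
        obtain ⟨b, hb⟩ := hR.mul_inv_cancel h0
        exact h₂ (IsUnit.of_mul_eq_one b hb)
      ext
      rw [Units.val_neg, Units.val_one]
      exact eq_neg_of_add_eq_zero_right h0
    rw [ha]
  · obtain ⟨r, hr⟩ := Cardinal.exists_notMem_of_length_lt [0, 1, (-1 : ResidueField R)]
      (lt_of_lt_of_le (by norm_num) hR)
    simp only [List.mem_cons, List.not_mem_nil, or_false, not_or] at hr
    obtain ⟨hr₀, hr₁, hr₂⟩ := hr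
    obtain ⟨s, rfl⟩ := residue_surjective r
    obtain ⟨b, rfl⟩ := (residue_ne_zero_iff_isUnit s).mp hr₀
    have ha : residue R (a : R) = -1 := by
      have h := (residue_eq_zero_iff (1 + (a : R))).mpr h₂
      rw [map_add, map_one] at h
      exact eq_neg_of_add_eq_zero_right h
    have hb₁ : IsUnit (1 - (b : R)) := by
      rw [← residue_ne_zero_iff_isUnit, map_sub, map_one]
      exact fun h => hr₁ (sub_eq_zero.mp h).symm
    have hb₂ : IsUnit (1 + (b : R)) := by
      rw [← residue_ne_zero_iff_isUnit, map_add, map_one]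
      exact fun h => hr₂ (eq_neg_of_add_eq_zero_right h)
    have hc₁ : IsUnit (1 - ((b⁻¹ * a : Rˣ) : R)) := by
      have h : (b : R) * (1 - ((b⁻¹ * a : Rˣ) : R)) = b - a := by simp [mul_sub]
      rw [← Units.isUnit_units_mul b, h, ← residue_ne_zero_iff_isUnit, map_sub, ha]
      exact fun h => hr₂ (sub_eq_zero.mp h)
    have hc₂ : IsUnit (1 + ((b⁻¹ * a : Rˣ) : R)) := by
      have h : (b : R) * (1 + ((b⁻¹ * a : Rˣ) : R)) = b + a := by simp [mul_add]
      rw [← Units.isUnit_units_mul b, h, ← residue_ne_zero_iff_isUnit, map_add, ha]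
      exact fun h => hr₁ (add_neg_eq_zero.mp h)
    rw [← mul_inv_cancel_left b a]
    exact gen_mul_commute (eta_mul_gen (-1)) (gen_commute_neg_one_of_isUnit hb₁ hb₂)
      (gen_commute_neg_one_of_isUnit hc₁ hc₂)

theorem gen_inv (hsq : ∀ a : Rˣ, gen R a * gen R a = gen R (-1) * gen R a) (a : Rˣ) :
    gen R a⁻¹ = gen R a := by
  have haa : gen R (a * a) = 0 := by
    rw [gen_mul, mul_assoc, hsq, ← mul_assoc, eta_mul_gen_neg_one, two_mul, sub_self]
  have h := gen_mul (a * a) a⁻¹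
  rwa [haa, mul_inv_cancel_right, zero_add, mul_zero, zero_mul, sub_zero, eq_comm] at h

theorem gen_mul_gen_of_add_eq (hsq : ∀ a : Rˣ, gen R a * gen R a = gen R (-1) * gen R a)
    (a b c : Rˣ) (hc : (c : R) = a + b) :
    gen R c * gen R (a * b * c) = gen R a * gen R b := by
  have hS : ∀ x ∈ insert (eta R) (Set.range (gen R)),
      ∀ y ∈ insert (eta R) (Set.range (gen R)), x * y = y * x := by
    rintro _ (rfl | ⟨a, rfl⟩) _ (rfl | ⟨b, rfl⟩)
    · rfl
    · exact eta_mul_gen b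
    · exact (eta_mul_gen a).symm
    · exact gen_commute hsq a b
  obtain ⟨A, _, f, hf, hfS⟩ := exists_commRing_of_pairwise_comm hS
  obtain ⟨t, ht⟩ := hfS (eta R) (Set.mem_insert _ _)
  choose g hg using fun a => hfS (gen R a) (Set.mem_insert_of_mem _ ⟨a, rfl⟩)
  have hac : gen R (a * c) = gen R (a * c⁻¹) := by
    rw [gen_mul, gen_mul a, gen_inv hsq]
  have hbc : gen R (b * c) = gen R (b * c⁻¹) := by
    rw [gen_mul, gen_mul b, gen_inv hsq]
  have hst : gen R (a * c) * gen R (b * c) = 0 := by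
    rw [hac, hbc]
    refine gen_mul_gen_of_add_eq_one ?_
    rw [Units.val_mul, Units.val_mul, ← add_mul, ← hc, Units.mul_inv]
  have key := mul_eq_mul_of_steinberg (t := t) (e := g (-1)) (x := g a) (y := g b) (z := g c)
    (hf (by rw [map_mul, ht, hg, eta_mul_gen_neg_one, map_ofNat]))
    (hf (by rw [map_mul, map_mul, hg, hg, hsq]))
    (hf (by simpa only [gen_mul, map_mul, map_add, map_sub, map_zero, hg, ht] using hst))
  simpa only [gen_mul, map_mul, map_add, map_sub, hg, ht] using congrArg f key

end Commutative

end KW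

open IsLocalRing in
/-- **Statement 13.** Let `R` be a local ring containing `1/2` (if `R` is not a field its
residue field has at least 5 elements).  In `KW_*(R)` one has
`[a+b]·[ab(a+b)] = [a]·[b]` for all units `a, b` of `R` with `a + b` a unit
(say `a + b = c`, `c ∈ Rˣ`). -/
theorem statement13 (R : Type) [CommRing R] [IsLocalRing R] [Invertible (2 : R)]
    (hR : IsField R ∨ 5 ≤ Cardinal.mk (ResidueField R))
    (a b c : Rˣ) (hc : (c : R) = (a : R) + (b : R)) :
    KW.gen R c * KW.gen R (a * b * c) = KW.gen R a * KW.gen R b := by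
  exact KW.gen_mul_gen_of_add_eq (KW.gen_mul_self hR) a b c hc
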